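/- arXiv:2003.05412 — 5 statements merged into one kernel-verified Lean document; each statement's English description precedes it below -/
import Mathlib

section
/- Assume Z_{Σ,Θ} ≠ ∅, ker(G) = {0}, and ran(G) ∩ 𝔥₁ = {0}. Then the family of bounded operators R_z + G_z(Θ + M_z)⁻¹G*_{z̄}, z ∈ Z_{Σ,Θ}, is the resolvent family of a (necessarily unique) self-adjoint operator H_Θ, i.e. (−H_Θ + z)⁻¹ = R_z + G_z(Θ + M_z)⁻¹G*_{z̄} for all z ∈ Z_{Σ,Θ}, and Z_{Σ,Θ} = ϱ(H) ∩ ϱ(H_Θ). Moreover dom(H_Θ) = {ψ ∈ 𝔉 : there exists φ ∈ dom(Θ) such that ψ₀ := ψ − Gφ ∈ 𝔥₁ and Σψ₀ = Θφ}, and for such ψ, (−H_Θ + λ₀)ψ = (−H + λ₀)ψ₀. -/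
noncomputable section

open scoped ComplexInnerProductSpace
open ContinuousLinearMap Filter

variable {F X : Type*}
  [NormedAddCommGroup F] [InnerProductSpace ℂ F] [CompleteSpace F]
  [NormedAddCommGroup X] [InnerProductSpace ℂ X] [CompleteSpace X]

/-- `W R l z = 1 + (z - l) • R`; the point `z` belongs to the resolvent set of the
self-adjoint operator `H` iff `W R l z` is boundedly invertible, where
`R = (-H + λ₀)⁻¹` and `l = λ₀ ∈ ϱ(H) ∩ ℝ` encode `H`. -/
def W (R : F →L[ℂ] F) (l : ℝ) (z : ℂ) : F →L[ℂ] F := 1 + (z - (l : ℂ)) • R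

/-- The resolvent set `ϱ(H)` of `H`, encoded through `R = (-H + λ₀)⁻¹`. -/
def res (R : F →L[ℂ] F) (l : ℝ) : Set ℂ := {z | IsUnit (W R l z)}

/-- The resolvent `R_z = (-H + z)⁻¹`. -/
def Rz (R : F →L[ℂ] F) (l : ℝ) (z : ℂ) : F →L[ℂ] F := R ∘L Ring.inverse (W R l z)

/-- `G_z = (Σ R_z̄)*`, where the bounded operator `B = Σ ∘ R : 𝔉 →L 𝔛` encodes the
(graph-norm bounded) operator `Σ : 𝔥₁ → 𝔛`. -/
def Gz (R : F →L[ℂ] F) (B : F →L[ℂ] X) (l : ℝ) (z : ℂ) : X →L[ℂ] F :=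
  adjoint (B ∘L Ring.inverse (W R l (starRingEnd ℂ z)))

/-- `(-H + λ₀) ψ`, for `ψ ∈ dom H = ran R`. -/
def Hinv (R : F →L[ℂ] F) (ψ : F) : F := Function.invFun (⇑R) ψ

/-- `Σ ψ`, for `ψ ∈ dom H = ran R`. -/
def SigmaOf (R : F →L[ℂ] F) (B : F →L[ℂ] X) (ψ : F) : X := B (Hinv R ψ)

/-- `Q` is the resolvent `(-K + z)⁻¹` of the (in general unbounded) operator `K`. -/
def IsResolventAt (K : F →ₗ.[ℂ] F) (z : ℂ) (Q : F →L[ℂ] F) : Prop :=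
  (∀ ψ : F, Q ψ ∈ K.domain) ∧
  (∀ (ψ : F) (h : Q ψ ∈ K.domain), z • Q ψ - K ⟨Q ψ, h⟩ = ψ) ∧
  (∀ ψ : K.domain, Q (z • (ψ : F) - K ψ) = (ψ : F))

/-- The resolvent set of the (in general unbounded) operator `K`. -/
def pres (K : F →ₗ.[ℂ] F) : Set ℂ := {z | ∃ Q : F →L[ℂ] F, IsResolventAt K z Q}

/-- `J ∈ B(𝔛)` is a two-sided bounded inverse of `Θ + M` (with domain `dom Θ`). -/
def IsBoundedInvOf (Θ : X →ₗ.[ℂ] X) (M : X → X) (J : X →L[ℂ] X) : Prop :=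
  (∀ y : X, J y ∈ Θ.domain) ∧
  (∀ (y : X) (h : J y ∈ Θ.domain), Θ ⟨J y, h⟩ + M (J y) = y) ∧
  (∀ x : Θ.domain, J (Θ x + M (x : X)) = (x : X))

/-- The set `Z_{Σ,Θ} = {z ∈ ϱ(H) : Θ + M_z` has a bounded inverse in `B(𝔛)}`,
where `M_z = Σ (G - G_z)`. -/
def ZSet (R : F →L[ℂ] F) (B : F →L[ℂ] X) (l : ℝ) (Θ : X →ₗ.[ℂ] X) : Set ℂ :=
  {z | z ∈ res R l ∧ ∃ J : X →L[ℂ] X,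
    IsBoundedInvOf Θ (fun x => SigmaOf R B ((Gz R B l l - Gz R B l z) x)) J}

section Graph

variable {E : Type*} [NormedAddCommGroup E] [InnerProductSpace ℂ E] [CompleteSpace E]

theorem mem_graph_iff_of_isSelfAdjoint {A : E →ₗ.[ℂ] E} (hA : IsSelfAdjoint A) (x y : E) :
    (x, y) ∈ A.graph ↔ ∀ a b, (a, b) ∈ A.graph → ⟪b, x⟫ = ⟪a, y⟫ := by
  have h := LinearPMap.adjoint_graph_eq_graph_adjoint hA.dense_domain
  rw [LinearPMap.isSelfAdjoint_def.mp hA] at h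
  conv_lhs => rw [h, Submodule.mem_adjoint_iff]
  simp only [sub_eq_zero]

theorem isSelfAdjoint_of_mem_graph_iff {A : E →ₗ.[ℂ] E} (hd : Dense (A.domain : Set E))
    (h : ∀ x y, (x, y) ∈ A.graph ↔ ∀ a b, (a, b) ∈ A.graph → ⟪b, x⟫ = ⟪a, y⟫) :
    IsSelfAdjoint A := by
  rw [LinearPMap.isSelfAdjoint_def]
  apply LinearPMap.eq_of_eq_graph
  rw [LinearPMap.adjoint_graph_eq_graph_adjoint hd]
  ext ⟨x, y⟩
  rw [h, Submodule.mem_adjoint_iff]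
  simp only [sub_eq_zero]

omit [CompleteSpace E] in
theorem isResolventAt_iff_graph (K : E →ₗ.[ℂ] E) (z : ℂ) (Q : E →L[ℂ] E) :
    IsResolventAt K z Q ↔
      (∀ h, (Q h, z • Q h - h) ∈ K.graph) ∧ ∀ x y, (x, y) ∈ K.graph → Q (z • x - y) = x := by
  constructor
  · rintro ⟨h1, h2, h3⟩
    refine ⟨fun h => ?_, fun x y hxy => ?_⟩
    · rw [LinearPMap.mem_graph_iff]
      exact ⟨⟨Q h, h1 h⟩, rfl, by rw [eq_sub_iff_add_eq, ← eq_sub_iff_add_eq', h2]⟩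
    · obtain ⟨u, rfl, rfl⟩ := (LinearPMap.mem_graph_iff K).mp hxy
      exact h3 u
  · rintro ⟨h1, h2⟩
    refine ⟨fun h => LinearPMap.mem_domain_of_mem_graph (h1 h), fun h hd => ?_,
      fun u => h2 _ _ (K.mem_graph u)⟩
    rw [K.mem_graph_snd_inj (K.mem_graph ⟨Q h, hd⟩) (h1 h) rfl, sub_sub_cancel]

omit [CompleteSpace E] in
theorem isBoundedInvOf_iff_graph (T : E →ₗ.[ℂ] E) (M : E → E) (J : E →L[ℂ] E) :
    IsBoundedInvOf T M J ↔
      (∀ y, (J y, y - M (J y)) ∈ T.graph) ∧ ∀ x t, (x, t) ∈ T.graph → J (t + M x) = x := by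
  constructor
  · rintro ⟨h1, h2, h3⟩
    refine ⟨fun y => ?_, fun x t hxt => ?_⟩
    · rw [LinearPMap.mem_graph_iff]
      exact ⟨⟨J y, h1 y⟩, rfl, by rw [eq_sub_iff_add_eq, h2]⟩
    · obtain ⟨u, rfl, rfl⟩ := (LinearPMap.mem_graph_iff T).mp hxt
      exact h3 u
  · rintro ⟨h1, h2⟩
    refine ⟨fun y => LinearPMap.mem_domain_of_mem_graph (h1 y), fun y hd => ?_,
      fun u => h2 _ _ (T.mem_graph u)⟩
    rw [T.mem_graph_snd_inj (T.mem_graph ⟨J y, hd⟩) (h1 y) rfl, sub_add_cancel]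

/-- An operator whose resolvents at `z` and `z̄` are adjoint to each other is self-adjoint. -/
theorem isSelfAdjoint_of_isResolventAt_adjoint {K : E →ₗ.[ℂ] E} {z : ℂ} {Q : E →L[ℂ] E}
    (h : IsResolventAt K z Q) (h' : IsResolventAt K (starRingEnd ℂ z) (adjoint Q)) :
    IsSelfAdjoint K := by
  rw [isResolventAt_iff_graph] at h h'
  obtain ⟨h1, h2⟩ := h
  obtain ⟨h1', h2'⟩ := h'
  apply isSelfAdjoint_of_mem_graph_iff
  · rw [Submodule.dense_iff_topologicalClosure_eq_top, Submodule.topologicalClosure_eq_top_iff,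
      Submodule.eq_bot_iff]
    intro v hv
    have h0 : adjoint Q v = 0 := by
      refine ext_inner_left ℂ fun a => ?_
      rw [adjoint_inner_right, inner_zero_right]
      exact (Submodule.mem_orthogonal _ _).mp hv _ (LinearPMap.mem_domain_of_mem_graph (h1 a))
    have := h1' v
    rw [h0, smul_zero, zero_sub] at this
    simpa using K.graph_fst_eq_zero_snd this rfl
  · intro x y
    constructor
    · intro hxy a b hab
      have ea := h2 a b hab
      have ex := h2' x y hxy
      have key : ⟪z • a - b, x⟫ = ⟪a, starRingEnd ℂ z • x - y⟫ := by
        conv_lhs => rw [← ex]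
        conv_rhs => rw [← ea]
        rw [adjoint_inner_right]
      rw [inner_sub_left, inner_sub_right, inner_smul_left, inner_smul_right] at key
      exact sub_right_injective key
    · intro hxy
      have hx : adjoint Q (starRingEnd ℂ z • x - y) = x := by
        refine ext_inner_left ℂ fun a => ?_
        have := hxy _ _ (h1 a)
        rw [inner_sub_left, inner_smul_left] at this
        rw [adjoint_inner_right, inner_sub_right, inner_smul_right, ← this, sub_sub_cancel]
      have := h1' (starRingEnd ℂ z • x - y)
      rwa [hx, sub_sub_cancel] at this

end Graph

section Resolvent

variable (R : F →L[ℂ] F) (B : F →L[ℂ] X) (l : ℝ)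

/-- The bounded inverse of `W R l z`, for `z` in the resolvent set. -/
def Winv (z : ℂ) : F →L[ℂ] F := Ring.inverse (W R l z)

/-- The bounded operator `M_z = Σ (G - G_z)`, in the form `(z - λ₀) B W_z⁻¹ B*`. -/
def weylOp (z : ℂ) : X →L[ℂ] X := (z - (l : ℂ)) • (B ∘L Winv R l z ∘L adjoint B)

variable {R B l}

theorem adjoint_W (hR : IsSelfAdjoint R) (z : ℂ) :
    adjoint (W R l z) = W R l (starRingEnd ℂ z) := by
  simp only [← star_eq_adjoint, W, star_add, star_one, star_smul, hR.star_eq]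
  simp

theorem adjoint_Winv (hR : IsSelfAdjoint R) (z : ℂ) :
    adjoint (Winv R l z) = Winv R l (starRingEnd ℂ z) := by
  rw [Winv, Winv, ← adjoint_W hR, ← star_eq_adjoint, ← star_eq_adjoint, Ring.inverse_star]

theorem conj_mem_res (hR : IsSelfAdjoint R) {z : ℂ} (hz : z ∈ res R l) :
    starRingEnd ℂ z ∈ res R l := by
  change IsUnit _
  rw [← adjoint_W hR, ← star_eq_adjoint]
  exact IsUnit.star hz

theorem Gz_eq (hR : IsSelfAdjoint R) (z : ℂ) : Gz R B l z = Winv R l z ∘L adjoint B := by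
  rw [Gz, adjoint_comp, ← Winv, adjoint_Winv hR, Complex.conj_conj]

theorem adjoint_Gz_conj (z : ℂ) :
    adjoint (Gz R B l (starRingEnd ℂ z)) = B ∘L Winv R l z := by
  rw [Gz, adjoint_adjoint, Complex.conj_conj, Winv]

theorem Gz_base (hR : IsSelfAdjoint R) : Gz R B l l = adjoint B := by
  rw [Gz_eq hR, Winv, W, sub_self, zero_smul, add_zero, Ring.inverse_one]
  rfl

omit [CompleteSpace F] in
theorem commute_Winv_Winv (z w : ℂ) : Commute (Winv R l z) (Winv R l w) := by
  apply Commute.ringInverse_ringInverse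
  unfold W
  have h : Commute ((z - (l : ℂ)) • R) ((w - (l : ℂ)) • R) :=
    ((Commute.refl R).smul_left _).smul_right _
  exact ((Commute.one_left _).add_left ((Commute.one_right _).add_right h))

omit [CompleteSpace F] in
theorem Winv_apply_add {z : ℂ} (hz : z ∈ res R l) (x : F) :
    Winv R l z x + (z - (l : ℂ)) • R (Winv R l z x) = x := by
  have := DFunLike.congr_fun (Ring.mul_inverse_cancel _ hz) x
  simpa [W, Winv] using this

omit [CompleteSpace F] in
theorem Winv_add_apply {z : ℂ} (hz : z ∈ res R l) (x : F) :
    Winv R l z (x + (z - (l : ℂ)) • R x) = x := by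
  have := DFunLike.congr_fun (Ring.inverse_mul_cancel _ hz) x
  simpa [W, Winv] using this

omit [CompleteSpace F] in
theorem Winv_eq_iff {z : ℂ} (hz : z ∈ res R l) (x y : F) :
    x = Winv R l z y ↔ x + (z - (l : ℂ)) • R x = y := by
  constructor
  · rintro rfl
    exact Winv_apply_add hz y
  · rintro rfl
    exact (Winv_add_apply hz x).symm

omit [CompleteSpace F] in
theorem Winv_apply_comm {z : ℂ} (hz : z ∈ res R l) (x : F) :
    Winv R l z (R x) = R (Winv R l z x) := by
  symm
  rw [Winv_eq_iff hz]
  conv_rhs => rw [← Winv_apply_add hz x]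
  rw [map_add, map_smul]

omit [CompleteSpace F] in
theorem Rz_eq (z : ℂ) : Rz R l z = R ∘L Winv R l z := rfl

theorem SigmaOf_sub_eq (hR : IsSelfAdjoint R) (hinj : Function.Injective ⇑R) {z : ℂ}
    (hz : z ∈ res R l) :
    (fun x => SigmaOf R B ((Gz R B l l - Gz R B l z) x)) = ⇑(weylOp R B l z) := by
  funext x
  have h : (Gz R B l l - Gz R B l z) x = R ((z - (l : ℂ)) • Winv R l z (adjoint B x)) := by
    rw [Gz_base hR, Gz_eq hR, sub_apply, comp_apply, sub_eq_iff_eq_add', map_smul,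
      Winv_apply_add hz]
  rw [h, SigmaOf, Hinv, Function.leftInverse_invFun hinj]
  simp [weylOp]

/-- The resolvent identity for `M_z`. -/
theorem weylOp_sub_apply {z w : ℂ} (hz : z ∈ res R l) (hw : w ∈ res R l) (x : X) :
    weylOp R B l z x - weylOp R B l w x
      = (z - w) • B (Winv R l w (Winv R l z (adjoint B x))) := by
  simp only [weylOp, smul_apply, comp_apply]
  set b := adjoint B x
  have hc : Winv R l w (Winv R l z b) = Winv R l z (Winv R l w b) :=
    DFunLike.congr_fun (commute_Winv_Winv w z) b
  have h1 := Winv_apply_add hw (Winv R l z b)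
  have h2 := Winv_apply_add hz (Winv R l w b)
  rw [← hc] at h2
  set v := Winv R l w (Winv R l z b)
  rw [← h1, ← h2]
  simp only [map_add, map_smul, smul_add, smul_smul]
  module

theorem adjoint_weylOp (hR : IsSelfAdjoint R) (z : ℂ) :
    adjoint (weylOp R B l z) = weylOp R B l (starRingEnd ℂ z) := by
  rw [weylOp, weylOp, ← adjoint_Winv hR]
  simp only [map_smulₛₗ, adjoint_comp, adjoint_adjoint]
  simp [comp_assoc]

end Resolvent

section Extension

variable (R : F →L[ℂ] F) (B : F →L[ℂ] X) (l : ℝ) (Θ : X →ₗ.[ℂ] X)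

/-- The graph of the extension `H_Θ`. -/
def extGraph : Submodule ℂ (F × F) where
  carrier := {p | ∃ φ, (φ, B ((l : ℂ) • p.1 - p.2)) ∈ Θ.graph ∧
    p.1 = R ((l : ℂ) • p.1 - p.2) + adjoint B φ}
  zero_mem' := ⟨0, by simp, by simp⟩
  add_mem' := by
    rintro ⟨a, b⟩ ⟨c, d⟩ ⟨φ, h1, h2⟩ ⟨φ', h1', h2'⟩
    refine ⟨φ + φ', ?_, ?_⟩
    · convert Θ.graph.add_mem h1 h1' using 1
      rw [Prod.mk_add_mk, Prod.mk_add_mk, ← map_add]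
      congr 2
      module
    · dsimp only [Prod.mk_add_mk] at h2 h2' ⊢
      have : (l : ℂ) • (a + c) - (b + d) = ((l : ℂ) • a - b) + ((l : ℂ) • c - d) := by module
      rw [this, map_add, map_add, add_add_add_comm, ← h2, ← h2']
  smul_mem' := by
    rintro t ⟨a, b⟩ ⟨φ, h1, h2⟩
    refine ⟨t • φ, ?_, ?_⟩
    · convert Θ.graph.smul_mem t h1 using 1
      rw [Prod.smul_mk, Prod.smul_mk, ← map_smul]
      congr 2
      module
    · dsimp only [Prod.smul_mk] at h2 ⊢
      have : (l : ℂ) • (t • a) - t • b = t • ((l : ℂ) • a - b) := by module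
      rw [this, map_smul, map_smul, ← smul_add, ← h2]

variable {R B l Θ}

theorem mem_extGraph {x y : F} : (x, y) ∈ extGraph R B l Θ ↔
    ∃ φ, (φ, B ((l : ℂ) • x - y)) ∈ Θ.graph ∧ x = R ((l : ℂ) • x - y) + adjoint B φ := Iff.rfl

theorem toLinearPMap_extGraph_graph (hinj : Function.Injective ⇑R)
    (hran : Set.range ⇑(adjoint B) ∩ Set.range ⇑R = {0}) :
    (extGraph R B l Θ).toLinearPMap.graph = extGraph R B l Θ := by
  apply Submodule.toLinearPMap_graph_eq
  rintro ⟨x, y⟩ hxy hx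
  obtain rfl : x = 0 := hx
  obtain ⟨φ, -, h⟩ := mem_extGraph.mp hxy
  rw [smul_zero, zero_sub, map_neg, eq_comm, neg_add_eq_zero] at h
  have h0 : adjoint B φ = 0 := by
    have : adjoint B φ ∈ Set.range ⇑(adjoint B) ∩ Set.range ⇑R := ⟨⟨φ, rfl⟩, ⟨y, h⟩⟩
    rwa [hran] at this
  exact hinj (by rw [h, h0, map_zero])

/-- Krein's description of the solutions of `(-H_Θ + z) ψ = h`. -/
theorem mem_extGraph_iff {z : ℂ} (hz : z ∈ res R l) (ψ h : F) :
    (ψ, z • ψ - h) ∈ extGraph R B l Θ ↔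
      ∃ φ, (φ, B (Winv R l z h) - weylOp R B l z φ) ∈ Θ.graph ∧
        ψ = R (Winv R l z h) + Winv R l z (adjoint B φ) := by
  rw [mem_extGraph]
  refine exists_congr fun φ => ?_
  have e : (l : ℂ) • ψ - (z • ψ - h) = h - (z - (l : ℂ)) • ψ := by module
  have hψ : ψ = R (h - (z - (l : ℂ)) • ψ) + adjoint B φ ↔
      ψ = R (Winv R l z h) + Winv R l z (adjoint B φ) := by
    rw [← Winv_apply_comm hz, ← map_add, Winv_eq_iff hz, map_sub, map_smul,
      ← eq_sub_iff_add_eq, add_sub_right_comm]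
  rw [e, hψ]
  refine and_congr_left fun hψ => ?_
  have : B (h - (z - (l : ℂ)) • ψ) = B (Winv R l z h) - weylOp R B l z φ := by
    have h1 := Winv_apply_add hz h
    rw [hψ]
    conv_lhs => enter [2, 1]; rw [← h1]
    simp only [weylOp, smul_apply, comp_apply, map_add, map_sub, map_smul, smul_add]
    abel
  rw [this]

theorem isResolventAt_of_isBoundedInvOf {K : F →ₗ.[ℂ] F} (hK : K.graph = extGraph R B l Θ)
    {z : ℂ} (hz : z ∈ res R l) {J : X →L[ℂ] X}
    (hJ : IsBoundedInvOf Θ (weylOp R B l z) J) :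
    IsResolventAt K z
      (R ∘L Winv R l z + (Winv R l z ∘L adjoint B) ∘L J ∘L (B ∘L Winv R l z)) := by
  rw [isBoundedInvOf_iff_graph] at hJ
  rw [isResolventAt_iff_graph, hK]
  refine ⟨fun h => ?_, fun x y hxy => ?_⟩
  · rw [mem_extGraph_iff hz]
    exact ⟨_, hJ.1 _, rfl⟩
  · obtain ⟨h, rfl⟩ : ∃ h, y = z • x - h := ⟨z • x - y, by abel⟩
    obtain ⟨φ, h1, h2⟩ := (mem_extGraph_iff hz x h).mp hxy
    have := hJ.2 _ _ h1
    rw [sub_add_cancel] at this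
    rw [sub_sub_cancel]
    conv_rhs => rw [h2, ← this]
    rfl

theorem exists_isBoundedInvOf_of_isResolventAt {K : F →ₗ.[ℂ] F}
    (hK : K.graph = extGraph R B l Θ) (hker : Function.Injective ⇑(adjoint B))
    {w z : ℂ} (hw : w ∈ res R l) (hz : z ∈ res R l) {J : X →L[ℂ] X}
    (hJ : IsBoundedInvOf Θ (weylOp R B l w) J) {Q : F →L[ℂ] F} (hQ : IsResolventAt K z Q) :
    ∃ J' : X →L[ℂ] X, IsBoundedInvOf Θ (weylOp R B l z) J' := by
  rw [isBoundedInvOf_iff_graph] at hJ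
  rw [isResolventAt_iff_graph, hK] at hQ
  let N : X →L[ℂ] F := -((z - w) • (Winv R l w ∘L adjoint B ∘L J))
  let D : F →L[ℂ] X :=
    B ∘L Winv R l z - (z - w) • (B ∘L Winv R l w ∘L (Q - R ∘L Winv R l z))
  let J' : X →L[ℂ] X := J + J ∘L D ∘L N
  have hJ' : ∀ y, (J' y, y - weylOp R B l z (J' y)) ∈ Θ.graph := by
    intro y
    obtain ⟨φ, h1, h2⟩ := (mem_extGraph_iff hz _ _).mp (hQ.1 (N y))
    have hφ : J (D (N y)) = φ := by
      have h3 := hJ.2 _ _ h1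
      have h4 := weylOp_sub_apply (B := B) hz hw φ
      have h5 : Winv R l z (adjoint B φ) = Q (N y) - R (Winv R l z (N y)) := by
        rw [h2, add_sub_cancel_left]
      rw [h5] at h4
      have h6 : D (N y) = B (Winv R l z (N y)) - weylOp R B l z φ + weylOp R B l w φ := by
        rw [sub_add, h4]
        rfl
      rw [h6, h3]
    have e : J' y = J y + φ := by
      rw [← hφ]
      rfl
    have h7 : B (Winv R l z (N y)) = -(weylOp R B l z (J y) - weylOp R B l w (J y)) := by
      have hc : Winv R l w (Winv R l z (adjoint B (J y)))
          = Winv R l z (Winv R l w (adjoint B (J y))) :=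
        DFunLike.congr_fun (commute_Winv_Winv w z) (adjoint B (J y))
      rw [weylOp_sub_apply hz hw, hc]
      simp [N]
    have := Θ.graph.add_mem (hJ.1 y) h1
    rw [e]
    convert this using 1
    rw [Prod.mk_add_mk, h7, map_add]
    congr 1
    abel
  refine ⟨J', (isBoundedInvOf_iff_graph _ _ _).mpr ⟨hJ', fun x t hxt => ?_⟩⟩
  have h1 := Θ.graph.sub_mem (hJ' (t + weylOp R B l z x)) hxt
  set x' := J' (t + weylOp R B l z x)
  have h2 : (Winv R l z (adjoint B (x' - x)), z • Winv R l z (adjoint B (x' - x)) - 0)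
      ∈ extGraph R B l Θ := by
    rw [mem_extGraph_iff hz]
    refine ⟨x' - x, ?_, by simp⟩
    convert h1 using 1
    rw [Prod.mk_sub_mk, map_sub, map_zero, map_zero]
    congr 1
    abel
  have h3 := hQ.2 _ _ h2
  rw [sub_zero, sub_self, map_zero] at h3
  have h4 := (Winv_eq_iff hz _ _).mp h3
  rw [map_zero, smul_zero, add_zero] at h4
  exact sub_eq_zero.mp (hker (by rw [← h4, map_zero]))

theorem isBoundedInvOf_adjoint (hR : IsSelfAdjoint R) (hΘ : IsSelfAdjoint Θ) {z : ℂ}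
    {J : X →L[ℂ] X} (hJ : IsBoundedInvOf Θ (weylOp R B l z) J) :
    IsBoundedInvOf Θ (weylOp R B l (starRingEnd ℂ z)) (adjoint J) := by
  rw [isBoundedInvOf_iff_graph] at hJ ⊢
  rw [← adjoint_weylOp hR]
  refine ⟨fun y => ?_, fun x t hxt => ?_⟩
  · rw [mem_graph_iff_of_isSelfAdjoint hΘ]
    intro a b hab
    rw [inner_sub_right, adjoint_inner_right, adjoint_inner_right, adjoint_inner_right,
      eq_sub_iff_add_eq, ← inner_add_left, ← map_add, hJ.2 a b hab]
  · refine ext_inner_left ℂ fun a => ?_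
    have h := (mem_graph_iff_of_isSelfAdjoint hΘ x t).mp hxt _ _ (hJ.1 a)
    rw [adjoint_inner_right, inner_add_right, adjoint_inner_right, ← h, ← inner_add_left,
      sub_add_cancel]

theorem isSelfAdjoint_of_graph_eq_extGraph (hR : IsSelfAdjoint R) (hΘ : IsSelfAdjoint Θ)
    {K : F →ₗ.[ℂ] F} (hK : K.graph = extGraph R B l Θ) {z : ℂ} (hz : z ∈ res R l)
    {J : X →L[ℂ] X} (hJ : IsBoundedInvOf Θ (weylOp R B l z) J) : IsSelfAdjoint K := by
  refine isSelfAdjoint_of_isResolventAt_adjoint (isResolventAt_of_isBoundedInvOf hK hz hJ) ?_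
  have hz' := conj_mem_res hR hz
  convert isResolventAt_of_isBoundedInvOf hK hz' (isBoundedInvOf_adjoint hR hΘ hJ) using 1
  have hc : R ∘L Winv R l (starRingEnd ℂ z) = Winv R l (starRingEnd ℂ z) ∘L R :=
    ContinuousLinearMap.ext fun x => (Winv_apply_comm hz' x).symm
  rw [hc, map_add]
  simp only [adjoint_comp, adjoint_adjoint, adjoint_Winv hR, comp_assoc]
  rw [← star_eq_adjoint R, hR.star_eq]

end Extension

/-- If `Z_{Σ,Θ} ≠ ∅`, `ker G = {0}` and `ran G ∩ 𝔥₁ = {0}`, then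
`R_z + G_z (Θ + M_z)⁻¹ G_z̄*`, `z ∈ Z_{Σ,Θ}`, is the resolvent family of a (unique)
self-adjoint operator `H_Θ`, `Z_{Σ,Θ} = ϱ(H) ∩ ϱ(H_Θ)`,
`dom H_Θ = {ψ : ∃ φ ∈ dom Θ, ψ₀ := ψ - G φ ∈ 𝔥₁ ∧ Σ ψ₀ = Θ φ}` and
`(-H_Θ + λ₀) ψ = (-H + λ₀) ψ₀`. -/
theorem statement1
    (R : F →L[ℂ] F) (B : F →L[ℂ] X) (l : ℝ)
    (hR : IsSelfAdjoint R) (hinj : Function.Injective ⇑R)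
    (Θ : X →ₗ.[ℂ] X) (hΘ : IsSelfAdjoint Θ)
    (hZ : (ZSet R B l Θ).Nonempty)
    (hkerG : Function.Injective ⇑(Gz R B l l))
    (hranG : Set.range ⇑(Gz R B l l) ∩ Set.range ⇑R = {0}) :
    ∃! Hθ : F →ₗ.[ℂ] F,
      IsSelfAdjoint Hθ ∧
      (∀ z ∈ ZSet R B l Θ, ∀ J : X →L[ℂ] X,
        IsBoundedInvOf Θ (fun x => SigmaOf R B ((Gz R B l l - Gz R B l z) x)) J →
        IsResolventAt Hθ z
          (Rz R l z + Gz R B l z ∘L J ∘L adjoint (Gz R B l (starRingEnd ℂ z)))) ∧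
      ZSet R B l Θ = res R l ∩ pres Hθ ∧
      (Hθ.domain : Set F)
        = {ψ | ∃ φ, ∃ hφ : φ ∈ Θ.domain,
            ψ - Gz R B l l φ ∈ Set.range ⇑R ∧
            SigmaOf R B (ψ - Gz R B l l φ) = Θ ⟨φ, hφ⟩} ∧
      (∀ (ψ : Hθ.domain) (φ : X), φ ∈ Θ.domain →
        (ψ : F) - Gz R B l l φ ∈ Set.range ⇑R →
        (l : ℂ) • (ψ : F) - Hθ ψ = Hinv R ((ψ : F) - Gz R B l l φ)) := by
  have hG := Gz_base (B := B) (l := l) hR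
  have hM : ∀ z ∈ res R l,
      (fun x => SigmaOf R B ((Gz R B l l - Gz R B l z) x)) = ⇑(weylOp R B l z) :=
    fun z hz => SigmaOf_sub_eq hR hinj hz
  rw [hG] at hkerG hranG
  have hHinv : ∀ x, Hinv R (R x) = x := Function.leftInverse_invFun hinj
  have hphi : ∀ φ φ' : X, adjoint B φ - adjoint B φ' ∈ Set.range ⇑R → φ = φ' := by
    intro φ φ' h
    have : adjoint B (φ - φ') ∈ Set.range ⇑(adjoint B) ∩ Set.range ⇑R :=
      ⟨⟨_, rfl⟩, by rwa [map_sub]⟩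
    rw [hranG, Set.mem_singleton_iff] at this
    exact sub_eq_zero.mp (hkerG (by rw [this, map_zero]))
  have hK := toLinearPMap_extGraph_graph (l := l) (Θ := Θ) hinj hranG
  set K := (extGraph R B l Θ).toLinearPMap
  obtain ⟨w, hw, Jw, hJw⟩ := hZ
  rw [hM w hw] at hJw
  have hres : ∀ z ∈ res R l, ∀ J : X →L[ℂ] X,
      IsBoundedInvOf Θ (fun x => SigmaOf R B ((Gz R B l l - Gz R B l z) x)) J →
      IsResolventAt K z
        (Rz R l z + Gz R B l z ∘L J ∘L adjoint (Gz R B l (starRingEnd ℂ z))) := by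
    intro z hz J hJ
    rw [hM z hz] at hJ
    rw [adjoint_Gz_conj, Gz_eq hR, Rz_eq]
    exact isResolventAt_of_isBoundedInvOf hK hz hJ
  have hdom : (K.domain : Set F) = {ψ | ∃ φ, ∃ hφ : φ ∈ Θ.domain,
      ψ - Gz R B l l φ ∈ Set.range ⇑R ∧ SigmaOf R B (ψ - Gz R B l l φ) = Θ ⟨φ, hφ⟩} := by
    ext ψ
    rw [SetLike.mem_coe, LinearPMap.mem_domain_iff, hK, hG]
    constructor
    · rintro ⟨k, φ, h1, h2⟩
      dsimp only at h1 h2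
      have h3 : ψ - adjoint B φ = R ((l : ℂ) • ψ - k) := sub_eq_iff_eq_add.mpr h2
      refine ⟨φ, LinearPMap.mem_domain_of_mem_graph h1, ⟨_, h3.symm⟩, ?_⟩
      rw [h3, SigmaOf, hHinv]
      exact Θ.mem_graph_snd_inj h1 (Θ.mem_graph _) rfl
    · rintro ⟨φ, hφ, ⟨f, hf⟩, h⟩
      refine ⟨(l : ℂ) • ψ - f, mem_extGraph.mpr ⟨φ, ?_, ?_⟩⟩
      · rw [sub_sub_cancel]
        rw [← hf, SigmaOf, hHinv] at h
        rw [h]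
        exact Θ.mem_graph ⟨φ, hφ⟩
      · rw [sub_sub_cancel, hf, sub_add_cancel]
  have hval : ∀ (ψ : K.domain) (φ : X), φ ∈ Θ.domain →
      (ψ : F) - Gz R B l l φ ∈ Set.range ⇑R →
      (l : ℂ) • (ψ : F) - K ψ = Hinv R ((ψ : F) - Gz R B l l φ) := by
    rintro ψ φ - ⟨f, hf⟩
    have h := K.mem_graph ψ
    rw [hK] at h
    obtain ⟨φ', -, h2⟩ := mem_extGraph.mp h
    rw [hG] at hf ⊢
    have h3 : (ψ : F) - adjoint B φ' = R ((l : ℂ) • (ψ : F) - K ψ) := sub_eq_iff_eq_add.mpr h2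
    have : φ' = φ := hphi _ _ ⟨f - ((l : ℂ) • (ψ : F) - K ψ), by
      rw [map_sub, hf, ← h3, sub_sub_sub_cancel_left]⟩
    rw [← this, h3, hHinv]
  refine ⟨K, ⟨isSelfAdjoint_of_graph_eq_extGraph hR hΘ hK hw hJw,
    fun z hz => hres z hz.1, ?_, hdom, hval⟩, ?_⟩
  · ext z
    constructor
    · rintro ⟨hz, J, hJ⟩
      exact ⟨hz, _, hres z hz J hJ⟩
    · rintro ⟨hz, Q, hQ⟩
      refine ⟨hz, ?_⟩
      rw [hM z hz]
      exact exists_isBoundedInvOf_of_isResolventAt hK hkerG hw hz hJw hQ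
  · rintro H ⟨-, -, -, hdom', hval'⟩
    refine LinearPMap.ext (SetLike.coe_injective (hdom'.trans hdom.symm)) fun x hx hx' => ?_
    obtain ⟨φ, hφ, hr, -⟩ : x ∈ {ψ | _} := hdom ▸ (show x ∈ (K.domain : Set F) from hx')
    exact sub_right_injective
      ((hval' ⟨x, hx⟩ φ hφ hr).trans (hval ⟨x, hx'⟩ φ hφ hr).symm)
end
end

section
/- Let S := H|ker(Σ), the restriction of H to ker(Σ) ⊆ 𝔥₁ (a symmetric operator). If ker(Σ) is dense in 𝔉, then S is densely defined and S^× ⊆ S* (the adjoint of S). If moreover Z_{Σ,Θ} ≠ ∅, then S ⊆ H_Θ ⊆ S^×; in particular H_Θ is a self-adjoint extension of S. -/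
noncomputable section

open scoped ComplexInnerProductSpace
open ContinuousLinearMap Filter

variable {F X : Type*}
  [NormedAddCommGroup F] [InnerProductSpace ℂ F] [CompleteSpace F]
  [NormedAddCommGroup X] [InnerProductSpace ℂ X] [CompleteSpace X]

/-- `Hθ` is the self-adjoint operator provided by the Kreĭn-type resolvent formula:
`ϱ(H) ∩ ϱ(H_Θ) = Z_{Σ,Θ}` and `(-H_Θ + z)⁻¹ = R_z + G_z (Θ + M_z)⁻¹ G_z̄*` on `Z_{Σ,Θ}`. -/
def IsKreinOp (R : F →L[ℂ] F) (B : F →L[ℂ] X) (l : ℝ) (Θ : X →ₗ.[ℂ] X)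
    (Hθ : F →ₗ.[ℂ] F) : Prop :=
  IsSelfAdjoint Hθ ∧
  ZSet R B l Θ = res R l ∩ pres Hθ ∧
  ∀ z ∈ ZSet R B l Θ, ∀ J : X →L[ℂ] X,
    IsBoundedInvOf Θ (fun x => SigmaOf R B ((Gz R B l l - Gz R B l z) x)) J →
    IsResolventAt Hθ z
      (Rz R l z + Gz R B l z ∘L J ∘L adjoint (Gz R B l (starRingEnd ℂ z)))

theorem star_W {R : F →L[ℂ] F} (hR : IsSelfAdjoint R) (l : ℝ) (z : ℂ) :
    star (W R l z) = W R l (starRingEnd ℂ z) := by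
  simp [W, hR.star_eq]

theorem Gz_self (R : F →L[ℂ] F) (B : F →L[ℂ] X) (l : ℝ) : Gz R B l l = adjoint B := by
  have h : W R l (starRingEnd ℂ (l : ℂ)) = 1 := by simp [W]
  rw [Gz, h, Ring.inverse_one]
  congr 1

theorem adjoint_Gz_conj_apply (R : F →L[ℂ] F) (B : F →L[ℂ] X) (l : ℝ) (z : ℂ) (f : F) :
    adjoint (Gz R B l (starRingEnd ℂ z)) f = B (Ring.inverse (W R l z) f) := by
  simp [Gz]

/-- The identity `(1 + (z - λ₀) R) G_z = G`. -/
theorem W_Gz_apply {R : F →L[ℂ] F} (hR : IsSelfAdjoint R) (B : F →L[ℂ] X) (l : ℝ) {z : ℂ}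
    (hz : z ∈ res R l) (φ : X) : W R l z (Gz R B l z φ) = Gz R B l l φ := by
  have hu : IsUnit (W R l (starRingEnd ℂ z)) := by
    rw [← star_W hR]
    exact IsUnit.star hz
  have hW : W R l z = star (W R l (starRingEnd ℂ z)) := by
    rw [star_W hR, Complex.conj_conj]
  have h : W R l z * star (Ring.inverse (W R l (starRingEnd ℂ z))) = 1 := by
    rw [hW, ← star_mul, Ring.inverse_mul_cancel _ hu, star_one]
  rw [Gz_self, Gz, adjoint_comp]
  exact DFunLike.congr_fun h (adjoint B φ)

theorem inverse_W_W_apply {E : Type*} [NormedAddCommGroup E] [InnerProductSpace ℂ E]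
    {R : E →L[ℂ] E} {l : ℝ} {z : ℂ} (hz : z ∈ res R l) (f : E) :
    Ring.inverse (W R l z) (W R l z f) = f :=
  DFunLike.congr_fun (Ring.inverse_mul_cancel _ hz) f

theorem W_inverse_W_apply {E : Type*} [NormedAddCommGroup E] [InnerProductSpace ℂ E]
    {R : E →L[ℂ] E} {l : ℝ} {z : ℂ} (hz : z ∈ res R l) (f : E) :
    W R l z (Ring.inverse (W R l z) f) = f :=
  DFunLike.congr_fun (Ring.mul_inverse_cancel _ hz) f

theorem W_apply {E : Type*} [NormedAddCommGroup E] [InnerProductSpace ℂ E]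
    (R : E →L[ℂ] E) (l : ℝ) (z : ℂ) (f : E) :
    W R l z f = f + (z - (l : ℂ)) • R f := by
  simp [W]

/-- Let `S := H|ker Σ` (here `ker Σ = R (ker B)`, `S (R χ) = λ₀ R χ - χ`).
If `ker Σ` is dense in `𝔉` then `S` is densely defined and `S^× ⊆ S*`, i.e. every
`ψ = R χ + G φ ∈ dom S^×` satisfies `⟨S^× ψ, ξ⟩ = ⟨ψ, S ξ⟩` for all `ξ ∈ dom S` (so that
`ψ ∈ dom S*` and `S* ψ = S^× ψ`).  If moreover `Z_{Σ,Θ} ≠ ∅` then `S ⊆ H_Θ ⊆ S^×`; in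
particular `H_Θ` is a self-adjoint extension of `S`. -/
theorem statement3
    (R : F →L[ℂ] F) (B : F →L[ℂ] X) (l : ℝ)
    (hR : IsSelfAdjoint R) (hinj : Function.Injective ⇑R)
    (hkerG : Function.Injective ⇑(Gz R B l l))
    (hranG : Set.range ⇑(Gz R B l l) ∩ Set.range ⇑R = {0})
    (Θ : X →ₗ.[ℂ] X) (hΘ : IsSelfAdjoint Θ)
    (hdense : Dense (⇑R '' {χ | B χ = 0} : Set F)) :
    (Dense (⇑R '' {χ | B χ = 0} : Set F) ∧
      ∀ (ψ χ : F) (φ : X), ψ = R χ + Gz R B l l φ →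
        ∀ χ₀ : F, B χ₀ = 0 →
          ⟪(l : ℂ) • ψ - χ, R χ₀⟫ = ⟪ψ, (l : ℂ) • R χ₀ - χ₀⟫) ∧
    ((ZSet R B l Θ).Nonempty →
      ∀ Hθ : F →ₗ.[ℂ] F, IsKreinOp R B l Θ Hθ →
        (∀ χ : F, B χ = 0 →
          ∃ h : R χ ∈ Hθ.domain, Hθ ⟨R χ, h⟩ = (l : ℂ) • R χ - χ) ∧
        (∀ ψ : Hθ.domain, ∃ (χ : F) (φ : X),
          (ψ : F) = R χ + Gz R B l l φ ∧ Hθ ψ = (l : ℂ) • (ψ : F) - χ)) := by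
  refine ⟨⟨hdense, ?_⟩, ?_⟩
  · rintro ψ χ φ rfl χ₀ hχ₀
    have hsym : ⟪R χ, χ₀⟫ = ⟪χ, R χ₀⟫ := hR.isSymmetric χ χ₀
    have hG : ⟪Gz R B l l φ, χ₀⟫ = 0 := by
      rw [Gz_self, adjoint_inner_left, hχ₀, inner_zero_right]
    simp only [inner_sub_left, inner_sub_right, inner_smul_left, inner_smul_right,
      inner_add_left, hsym, hG, Complex.conj_ofReal, add_zero]
  · rintro ⟨z, hz⟩ Hθ ⟨-, -, hK⟩
    obtain ⟨hzr, J, hJ⟩ := id hz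
    obtain ⟨hdom, hright, hleft⟩ := hK z hz J hJ
    set Q := Rz R l z + Gz R B l z ∘L J ∘L adjoint (Gz R B l (starRingEnd ℂ z)) with hQ
    have hQ_apply (f : F) : Q f = R (Ring.inverse (W R l z) f) +
        Gz R B l z (J (B (Ring.inverse (W R l z) f))) := by
      simp only [hQ, add_apply, comp_apply, adjoint_Gz_conj_apply, Rz]
    refine ⟨fun χ hχ => ?_, fun ψ => ?_⟩
    · have hQχ : Q (W R l z χ) = R χ := by
        rw [hQ_apply, inverse_W_W_apply hzr, hχ, map_zero, map_zero, add_zero]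
      have h : R χ ∈ Hθ.domain := hQχ ▸ hdom (W R l z χ)
      refine ⟨h, ?_⟩
      have e : z • R χ - Hθ ⟨R χ, h⟩ = W R l z χ := by
        simpa only [hQχ] using hright (W R l z χ) (hdom _)
      calc Hθ ⟨R χ, h⟩ = z • R χ - (z • R χ - Hθ ⟨R χ, h⟩) := (sub_sub_cancel _ _).symm
        _ = (l : ℂ) • R χ - χ := by
          rw [e, W_apply]
          module
    · set f : F := z • (ψ : F) - Hθ ψ with hf
      set w := Ring.inverse (W R l z) f with hw
      set g := Gz R B l z (J (B w)) with hg
      have hψ : (ψ : F) = R w + g := by rw [← hleft ψ, hQ_apply]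
      have hGg : g + (z - (l : ℂ)) • R g = Gz R B l l (J (B w)) := by
        rw [← W_apply, hg, W_Gz_apply hR B l hzr]
      have hfw : f = w + (z - (l : ℂ)) • R w := by
        rw [← W_apply, hw, W_inverse_W_apply hzr]
      refine ⟨w - (z - (l : ℂ)) • g, J (B w), ?_, ?_⟩
      · rw [← hGg, hψ, map_sub, map_smul]
        module
      · have hH : Hθ ψ = z • (ψ : F) - f := by rw [hf]; module
        rw [hH, hfw, hψ]
        module
end
end

section
/- (Weak form of the additive representation S^× = (H̄ + Σ*Σ_*)|dom(S^×).) For every ψ ∈ dom(S^×) and every φ ∈ 𝔥₁: ⟨S^×ψ, φ⟩ = ⟨ψ, Hφ⟩ + (Σ_*ψ, Σφ). -/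
noncomputable section

open scoped ComplexInnerProductSpace
open ContinuousLinearMap Filter

variable {F X : Type*}
  [NormedAddCommGroup F] [InnerProductSpace ℂ F] [CompleteSpace F]
  [NormedAddCommGroup X] [InnerProductSpace ℂ X] [CompleteSpace X]

theorem W_self (R : F →L[ℂ] F) (l : ℝ) : W R l l = 1 := by
  simp [W]

/-- weak form of `S^× = (H̄ + Σ* Σ_*)|dom S^×`.  For every
`ψ ∈ dom S^×`, written `ψ = ψ₀ + G φ = R χ + G φ` (so `S^× ψ = λ₀ ψ - χ`, `Σ_* ψ = φ`),
and every element `R ξ` of `𝔥₁` (so `H (R ξ) = λ₀ R ξ - ξ` and `Σ (R ξ) = B ξ`):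
`⟨S^× ψ, R ξ⟩ = ⟨ψ, H (R ξ)⟩ + (Σ_* ψ, Σ (R ξ))`. -/
theorem statement5
    (R : F →L[ℂ] F) (B : F →L[ℂ] X) (l : ℝ)
    (hR : IsSelfAdjoint R) (hinj : Function.Injective ⇑R)
    (hkerG : Function.Injective ⇑(Gz R B l l))
    (hranG : Set.range ⇑(Gz R B l l) ∩ Set.range ⇑R = {0})
    (ψ χ : F) (φ : X) (hψ : ψ = R χ + Gz R B l l φ) (ξ : F) :
    ⟪(l : ℂ) • ψ - χ, R ξ⟫ = ⟪ψ, (l : ℂ) • R ξ - ξ⟫ + ⟪φ, B ξ⟫ := by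
  have hsymm : ⟪R χ, ξ⟫ = ⟪χ, R ξ⟫ := hR.isSymmetric χ ξ
  have hadj : ⟪Gz R B l l φ, ξ⟫ = ⟪φ, B ξ⟫ := by
    rw [Gz_self, adjoint_inner_left]
  have hψξ : ⟪ψ, ξ⟫ = ⟪χ, R ξ⟫ + ⟪φ, B ξ⟫ := by
    rw [hψ, inner_add_left, hsymm, hadj]
  rw [inner_sub_left, inner_sub_right, inner_smul_left, inner_smul_right,
    Complex.conj_ofReal, hψξ]
  ring
end
end

section
/- Let Σ₀ denote Σ regarded as a densely defined operator in 𝔉, i.e. Σ₀ : 𝔥₁ ⊆ 𝔉 → 𝔛, Σ₀ψ := Σψ. If Σ₀ is closable (equivalently, its adjoint Σ₀* is densely defined) and ran(G) ∩ 𝔥₁ = {0}, then Σ = 0. Equivalently: if Σ is not identically zero and Σ₀ is closable, then the hypothesis ran(G) ∩ 𝔥₁ = {0} fails. -/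
noncomputable section

open scoped ComplexInnerProductSpace
open ContinuousLinearMap Filter

variable {F X : Type*}
  [NormedAddCommGroup F] [InnerProductSpace ℂ F] [CompleteSpace F]
  [NormedAddCommGroup X] [InnerProductSpace ℂ X] [CompleteSpace X]

open scoped InnerProductSpace in
/-- If every pair orthogonal to all `(R χ, B χ)` is also orthogonal to `p`, then `p` lies in the
closure of the set of the pairs `(R χ, B χ)`. -/
theorem mem_closure_range_prod_of_forall_inner
    (R : F →L[ℂ] F) (B : F →L[ℂ] X) (p : F × X)
    (hp : ∀ a x, (∀ χ, ⟪R χ, a⟫_ℂ + ⟪B χ, x⟫_ℂ = 0) → ⟪a, p.1⟫_ℂ + ⟪x, p.2⟫_ℂ = 0) :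
    p ∈ closure (Set.range fun χ => (R χ, B χ)) := by
  let e := WithLp.prodContinuousLinearEquiv 2 ℂ F X
  let K : Submodule ℂ (WithLp 2 (F × X)) :=
    LinearMap.range (e.symm.toLinearEquiv.toLinearMap ∘ₗ (R.prod B).toLinearMap)
  have hK : e.symm p ∈ K.topologicalClosure := by
    rw [← K.orthogonal_orthogonal_eq_closure, Submodule.mem_orthogonal]
    intro u hu
    refine hp (WithLp.ofLp u).1 (WithLp.ofLp u).2 fun χ => ?_
    exact (Submodule.mem_orthogonal _ _).1 hu _ ⟨χ, rfl⟩
  refine map_mem_closure e.continuous hK ?_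
  rintro _ ⟨χ, rfl⟩
  exact ⟨χ, rfl⟩

open scoped InnerProductSpace in
/-- If `R` is self-adjoint and `ran B* ∩ ran R = {0}`, then the closure of the set of the pairs
`(R χ, B χ)` contains `(0, B η)` for every `η`. -/
theorem zero_prod_mem_closure_range_prod
    (R : F →L[ℂ] F) (B : F →L[ℂ] X) (hR : IsSelfAdjoint R)
    (hran : Set.range ⇑(adjoint B) ∩ Set.range ⇑R = {0}) (η : F) :
    ((0 : F), B η) ∈ closure (Set.range fun χ => (R χ, B χ)) := by
  refine mem_closure_range_prod_of_forall_inner R B _ fun a x h => ?_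
  have hax : adjoint B x = R (-a) := by
    refine ext_inner_left ℂ fun χ => ?_
    rw [adjoint_inner_right, map_neg, inner_neg_right, show ⟪χ, R a⟫_ℂ = ⟪R χ, a⟫_ℂ from (hR.isSymmetric χ a).symm]
    exact eq_neg_of_add_eq_zero_right (h χ)
  have hx : adjoint B x ∈ ({0} : Set F) := hran ▸ ⟨⟨x, rfl⟩, ⟨-a, hax.symm⟩⟩
  rw [inner_zero_right, zero_add, ← adjoint_inner_left, Set.mem_singleton_iff.1 hx,
    inner_zero_left]

/-- Let `Σ₀` be `Σ` regarded as a densely defined operator in `𝔉`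
(domain `𝔥₁ = ran R`, `Σ₀ (R χ) = B χ`).  If `Σ₀` is closable and
`ran G ∩ 𝔥₁ = {0}`, then `Σ = 0` (i.e. `B = 0`). -/
theorem statement10
    (R : F →L[ℂ] F) (B : F →L[ℂ] X) (l : ℝ)
    (hR : IsSelfAdjoint R) (hinj : Function.Injective ⇑R)
    (S0 : F →ₗ.[ℂ] X)
    (hdom : (S0.domain : Set F) = Set.range ⇑R)
    (hact : ∀ (χ : F) (h : R χ ∈ S0.domain), S0 ⟨R χ, h⟩ = B χ)
    (hclos : S0.IsClosable)
    (hranG : Set.range ⇑(Gz R B l l) ∩ Set.range ⇑R = {0}) :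
    B = 0 := by
  rw [Gz_self] at hranG
  obtain ⟨T, hT⟩ := hclos
  ext η
  refine T.graph_fst_eq_zero_snd (x := 0) ?_ rfl
  rw [← hT]
  refine closure_mono ?_ (zero_prod_mem_closure_range_prod R B hR hranG η)
  rintro _ ⟨χ, rfl⟩
  have hχ : R χ ∈ S0.domain := by
    rw [← SetLike.mem_coe, hdom]
    exact ⟨χ, rfl⟩
  exact S0.mem_graph_iff.2 ⟨⟨R χ, hχ⟩, rfl, hact χ hχ⟩
end
end

section
/- dom(S^×_T) = {ψ ∈ dom(A_T) : A_*ψ = ψ}; the operator S^×_T is symmetric, i.e. ⟨S^×_Tψ, φ⟩ = ⟨ψ, S^×_Tφ⟩ for all ψ, φ ∈ dom(S^×_T); and dom(S^×_T) ∩ 𝔥₁ = {0}. -/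
noncomputable section

open scoped ComplexInnerProductSpace
open ContinuousLinearMap Filter

variable {F X : Type*}
  [NormedAddCommGroup F] [InnerProductSpace ℂ F] [CompleteSpace F]
  [NormedAddCommGroup X] [InnerProductSpace ℂ X] [CompleteSpace X]

/-- A self-adjoint partially defined operator is symmetric. -/
theorem inner_map_of_isSelfAdjoint {T : F →ₗ.[ℂ] F} (hT : IsSelfAdjoint T) (x y : T.domain) :
    ⟪T x, (y : F)⟫ = ⟪(x : F), T y⟫ := by
  have h := LinearPMap.adjoint_isFormalAdjoint hT.dense_domain
  rw [LinearPMap.isSelfAdjoint_def.mp hT] at h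
  exact h x y

/-- The singular part of `S^×` combined with `A₀` is symmetric: for `ψ - B† ψ = R χ` and
`ψ' - B† ψ' = R χ'`, the form `⟪B χ - χ, ψ'⟫` reduces to `-⟪χ, R χ'⟫`. -/
theorem inner_sub_eq_neg_inner (R B : F →L[ℂ] F) {ψ χ χ' : F}
    (h : ψ - adjoint B ψ = R χ') : ⟪B χ - χ, ψ⟫ = -⟪χ, R χ'⟫ := by
  rw [← h, inner_sub_left, inner_sub_right, adjoint_inner_right]
  ring

/-- `dom S^×_T = {ψ ∈ dom A_T : A_* ψ = ψ}`, the operator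
`S^×_T ψ = S^× ψ + A_T ψ` is symmetric, and `dom S^×_T ∩ 𝔥₁ = {0}`.
(For `ψ ∈ dom S^×_T`, writing `ψ - G ψ = R χ`, one has
`S^×_T ψ = λ₀ ψ - χ + B χ + T ψ`.) -/
theorem statement11
    (R B : F →L[ℂ] F) (l : ℝ)
    (hR : IsSelfAdjoint R) (hinj : Function.Injective ⇑R)
    (hkerG : Function.Injective ⇑(Gz R B l l))
    (hranG : Set.range ⇑(Gz R B l l) ∩ Set.range ⇑R = {0})
    (T : F →ₗ.[ℂ] F) (hT : IsSelfAdjoint T) :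
    ({ψ : F | ψ ∈ T.domain ∧ ψ - Gz R B l l ψ ∈ Set.range ⇑R}
       = {ψ : F | ∃ φ : F, ψ - Gz R B l l φ ∈ Set.range ⇑R ∧
            φ ∈ T.domain ∧ φ = ψ}) ∧
    (∀ (ψ ψ' χ χ' : F) (hψT : ψ ∈ T.domain) (hψ'T : ψ' ∈ T.domain),
      ψ - Gz R B l l ψ = R χ → ψ' - Gz R B l l ψ' = R χ' →
      ⟪(l : ℂ) • ψ - χ + B χ + T ⟨ψ, hψT⟩, ψ'⟫
        = ⟪ψ, (l : ℂ) • ψ' - χ' + B χ' + T ⟨ψ', hψ'T⟩⟫) ∧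
    (∀ ψ : F, ψ ∈ T.domain → ψ - Gz R B l l ψ ∈ Set.range ⇑R →
      ψ ∈ Set.range ⇑R → ψ = 0) := by
  rw [Gz_self] at *
  refine ⟨by ext ψ; simp [and_comm], ?_, ?_⟩
  · intro ψ ψ' χ χ' hψT hψ'T hψ hψ'
    have hTsymm := inner_map_of_isSelfAdjoint hT ⟨ψ, hψT⟩ ⟨ψ', hψ'T⟩
    have h₁ := inner_sub_eq_neg_inner R B (χ := χ) hψ'
    have h₂ : ⟪ψ, B χ' - χ'⟫ = -⟪χ, R χ'⟫ := by
      rw [← inner_conj_symm, inner_sub_eq_neg_inner R B hψ, map_neg, inner_conj_symm]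
      exact congrArg Neg.neg (hR.isSymmetric χ χ')
    have h₃ : ⟪(l : ℂ) • ψ, ψ'⟫ = ⟪ψ, (l : ℂ) • ψ'⟫ := by
      rw [inner_smul_left, inner_smul_right, Complex.conj_ofReal]
    rw [inner_sub_left] at h₁
    rw [inner_sub_right] at h₂
    simp only [inner_add_left, inner_add_right, inner_sub_left, inner_sub_right]
    linear_combination h₁ - h₂ + h₃ + hTsymm
  · rintro ψ - ⟨χ, hχ⟩ ⟨η, hη⟩
    have hmem : adjoint B ψ ∈ Set.range ⇑(adjoint B) ∩ Set.range ⇑R :=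
      ⟨⟨ψ, rfl⟩, η - χ, by rw [map_sub, hχ, hη, sub_sub_cancel]⟩
    rw [hranG, Set.mem_singleton_iff] at hmem
    exact hkerG (hmem.trans (map_zero _).symm)
end
end
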